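/- Let D > 0, b ∈ ℝ, and let f : ℝ × ℝ → ℝ be smooth with the property that there is a compact set K ⊆ ℝ such that y ↦ f(y,t) vanishes outside K for every t. Define u(x,t) = ∫_ℝ G(x − y, t)·exp(−bt)·f(y,t) dy, where G is the heat kernel. Then for all x ∈ ℝ and t > 0, the Fisher–KPP differential operator applied to u reduces to the convolution of the Green's function with the time derivative of f: ∂u/∂t (x,t) − D·∂²u/∂x² (x,t) + b·u(x,t) = ∫_ℝ G(x − y, t)·exp(−bt)·(∂f/∂t)(y,t) dy. -/

import Mathlib

open Real MeasureTheory

/-- The heat kernel with diffusion constant `D`. -/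
noncomputable def heatKernel (D x t : ℝ) : ℝ :=
  Real.exp (-x ^ 2 / (4 * D * t)) / Real.sqrt (4 * Real.pi * D * t)

open Topology in
lemma diff_param (F F' : ℝ → ℝ → ℝ) (K : Set ℝ) (hK : IsCompact K) (p r : ℝ) (hr : 0 < r)
    (hF : ContinuousOn (fun q : ℝ × ℝ => F q.1 q.2) (Metric.closedBall p r ×ˢ Set.univ))
    (hF' : ContinuousOn (fun q : ℝ × ℝ => F' q.1 q.2) (Metric.closedBall p r ×ˢ Set.univ))
    (h0 : ∀ s, ∀ y ∉ K, F s y = 0) (h0' : ∀ s, ∀ y ∉ K, F' s y = 0)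
    (hd : ∀ s ∈ Metric.closedBall p r, ∀ y, HasDerivAt (fun s => F s y) (F' s y) s) :
    Integrable (F p) ∧ Integrable (F' p) ∧
      HasDerivAt (fun s => ∫ y, F s y) (∫ y, F' p y) p := by
  have hc : ∀ H : ℝ → ℝ → ℝ,
      ContinuousOn (fun q : ℝ × ℝ => H q.1 q.2) (Metric.closedBall p r ×ˢ Set.univ) →
      ∀ s ∈ Metric.closedBall p r, Continuous (H s) := by
    intro H hH s hs
    have := hH.comp_continuous (f := fun y : ℝ => (s, y)) (by fun_prop) (fun y => ⟨hs, trivial⟩)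
    exact this
  have hp : p ∈ Metric.closedBall p r := Metric.mem_closedBall_self hr.le
  have hFi : Integrable (F p) :=
    (hc F hF p hp).integrable_of_hasCompactSupport (HasCompactSupport.intro hK (h0 p))
  obtain ⟨C, hC⟩ := ((isCompact_closedBall p r).prod hK).exists_bound_of_continuousOn
    (hF'.mono (Set.prod_mono le_rfl (Set.subset_univ _)))
  refine ⟨hFi, hasDerivAt_integral_of_dominated_loc_of_deriv_le
    (bound := K.indicator (fun _ => C)) (Metric.closedBall_mem_nhds p hr) ?_ hFi
    (hc F' hF' p hp).aestronglyMeasurable ?_ ?_ ?_⟩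
  · filter_upwards [Metric.closedBall_mem_nhds p hr] with s hs
    exact (hc F hF s hs).aestronglyMeasurable
  · refine Filter.Eventually.of_forall fun y s hs => ?_
    by_cases hy : y ∈ K
    · rw [Set.indicator_of_mem hy]
      exact hC (s, y) ⟨hs, hy⟩
    · rw [Set.indicator_of_notMem hy, h0' s y hy, norm_zero]
  · rw [integrable_indicator_iff hK.measurableSet]
    exact integrableOn_const hK.measure_lt_top.ne
  · exact Filter.Eventually.of_forall fun y s hs => hd s hs y

lemma heatKernel_hasDerivAt_x (D t z : ℝ) :
    HasDerivAt (fun z => heatKernel D z t) (-z / (2 * D * t) * heatKernel D z t) z := by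
  unfold heatKernel
  have h1 : HasDerivAt (fun z : ℝ => -z ^ 2 / (4 * D * t)) (-(2 * z) / (4 * D * t)) z := by
    simpa using ((hasDerivAt_pow 2 z).neg).div_const (4 * D * t)
  refine HasDerivAt.congr_deriv ((h1.exp).div_const (Real.sqrt (4 * Real.pi * D * t))) ?_
  have : -(2 * z) / (4 * D * t) = -z / (2 * D * t) := by
    rw [show 4 * D * t = 2 * (2 * D * t) by ring, neg_mul_eq_mul_neg,
      mul_div_mul_left _ _ two_ne_zero]
  rw [this]; ring

lemma heatKernel_hasDerivAt_t (D t z : ℝ) (hD : 0 < D) (ht : 0 < t) :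
    HasDerivAt (fun t => heatKernel D z t)
      ((z ^ 2 / (4 * D * t ^ 2) - 1 / (2 * t)) * heatKernel D z t) t := by
  unfold heatKernel
  have hpos : 0 < 4 * Real.pi * D * t := by positivity
  have h1 : HasDerivAt (fun t : ℝ => -z ^ 2 / (4 * D * t)) (z ^ 2 / (4 * D * t ^ 2)) t := by
    have := (hasDerivAt_const t (-z ^ 2)).fun_div ((hasDerivAt_id t).const_mul (4 * D))
      (by simp; constructor <;> positivity)
    refine HasDerivAt.congr_deriv (this) ?_
    simp; field_simp
  have h2 : HasDerivAt (fun t : ℝ => Real.sqrt (4 * Real.pi * D * t))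
      (4 * Real.pi * D / (2 * Real.sqrt (4 * Real.pi * D * t))) t := by
    have := ((hasDerivAt_id t).const_mul (4 * Real.pi * D)).sqrt (by simpa using hpos.ne')
    simpa using this
  refine HasDerivAt.congr_deriv ((h1.exp).fun_div h2 (Real.sqrt_pos.2 hpos).ne') ?_
  have hs := Real.sq_sqrt hpos.le
  have hs0 := (Real.sqrt_pos.2 hpos).ne'
  set S := Real.sqrt (4 * Real.pi * D * t)
  have h4 : 4 * Real.pi * D = S ^ 2 / t := by rw [hs]; field_simp
  rw [h4]
  field_simp

lemma heatKernel_cont (D : ℝ) (hD : 0 < D) :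
    ContinuousOn (fun q : ℝ × ℝ => heatKernel D q.1 q.2) {q | 0 < q.2} := by
  unfold heatKernel
  have hpi := Real.pi_pos
  refine ContinuousOn.div (ContinuousOn.rexp (ContinuousOn.div (by fun_prop) (by fun_prop) ?_))
    (by fun_prop) ?_
  · intro q (hq : 0 < q.2); positivity
  · intro q (hq : 0 < q.2); positivity

/-- For the ansatz `u = (G e^{−bt}) ⋆ f`, the linear part of the Fisher–KPP differential
operator applied to `u` reduces to the convolution of the Green's function with `∂f/∂t`. -/
theorem fisherKPP_residual (D b : ℝ) (hD : 0 < D) (f : ℝ → ℝ → ℝ)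
    (hf : ContDiff ℝ (⊤ : ℕ∞) (fun p : ℝ × ℝ => f p.1 p.2))
    (hsupp : ∃ K : Set ℝ, IsCompact K ∧ ∀ y t : ℝ, y ∉ K → f y t = 0)
    (x t : ℝ) (ht : 0 < t) :
    deriv (fun τ => ∫ y : ℝ, heatKernel D (x - y) τ * Real.exp (-b * τ) * f y τ) t
      - D * deriv (deriv (fun ξ => ∫ y : ℝ,
          heatKernel D (ξ - y) t * Real.exp (-b * t) * f y t)) x
      + b * ∫ y : ℝ, heatKernel D (x - y) t * Real.exp (-b * t) * f y t
    = ∫ y : ℝ, heatKernel D (x - y) t * Real.exp (-b * t)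
        * deriv (fun τ => f y τ) t := by
  obtain ⟨K, hK, hz⟩ := hsupp
  set g : ℝ → ℝ → ℝ := fun y s => deriv (fun τ => f y τ) s with hg
  have hfc : Continuous (fun p : ℝ × ℝ => f p.1 p.2) := hf.continuous
  have hfd : ∀ y s, HasDerivAt (fun τ => f y τ)
      (fderiv ℝ (fun p : ℝ × ℝ => f p.1 p.2) (y, s) (0, 1)) s := by
    intro y s
    have h1 := ((hf.differentiable (by simp)) (y, s)).hasFDerivAt
    have h2 : HasDerivAt (fun τ : ℝ => (y, τ)) ((0 : ℝ), (1 : ℝ)) s :=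
      (hasDerivAt_const s y).prodMk (hasDerivAt_id s)
    exact h1.comp_hasDerivAt s h2
  have hge : ∀ y s, g y s = fderiv ℝ (fun p : ℝ × ℝ => f p.1 p.2) (y, s) (0, 1) :=
    fun y s => (hfd y s).deriv
  have hgd : ∀ y s, HasDerivAt (fun τ => f y τ) (g y s) s := by
    intro y s; rw [hge]; exact hfd y s
  have hgc : Continuous (fun p : ℝ × ℝ => g p.1 p.2) := by
    simp only [hge]
    exact (hf.continuous_fderiv (by simp)).clm_apply continuous_const
  have hgz : ∀ y s, y ∉ K → g y s = 0 := by
    intro y s hy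
    have : (fun τ => f y τ) = fun _ => 0 := funext fun τ => hz y τ hy
    simp [hg, this]
  have hGx : Continuous (fun q : ℝ × ℝ => heatKernel D (q.1 - q.2) t) := by
    exact (heatKernel_cont D hD).comp_continuous (f := fun q : ℝ × ℝ => (q.1 - q.2, t))
      (by fun_prop) (fun q => ht)
  have hfx : Continuous (fun q : ℝ × ℝ => f q.2 t) :=
    hfc.comp (by fun_prop : Continuous fun q : ℝ × ℝ => (q.2, t))
  have hGd : ∀ s y, HasDerivAt (fun s => heatKernel D (s - y) t)
      (-(s - y) / (2 * D * t) * heatKernel D (s - y) t) s := by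
    intro s y
    simpa using (heatKernel_hasDerivAt_x D t (s - y)).comp_sub_const s y
  -- first space derivative
  have X1 := fun p => diff_param (fun s y => heatKernel D (s - y) t * Real.exp (-b * t) * f y t)
    (fun s y => -(s - y) / (2 * D * t) * heatKernel D (s - y) t * Real.exp (-b * t) * f y t)
    K hK p 1 one_pos (by fun_prop) (by fun_prop)
    (fun s y hy => by simp [hz y t hy]) (fun s y hy => by simp [hz y t hy])
    (fun s _ y => ((hGd s y).mul_const _).mul_const _)
  have X2 := diff_param
    (fun s y => -(s - y) / (2 * D * t) * heatKernel D (s - y) t * Real.exp (-b * t) * f y t)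
    (fun s y => ((s - y) ^ 2 / (4 * D ^ 2 * t ^ 2) - 1 / (2 * D * t))
      * heatKernel D (s - y) t * Real.exp (-b * t) * f y t)
    K hK x 1 one_pos (by fun_prop) (by fun_prop)
    (fun s y hy => by simp [hz y t hy]) (fun s y hy => by simp [hz y t hy])
    (fun s _ y => by
      have h1 : HasDerivAt (fun s : ℝ => -(s - y) / (2 * D * t)) (-1 / (2 * D * t)) s :=
        (((hasDerivAt_id s).sub_const y).fun_neg).div_const _
      refine HasDerivAt.congr_deriv (((h1.fun_mul (hGd s y)).mul_const (Real.exp (-b * t))).mul_const (f y t)) ?_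
      field_simp
      ring)
  have hball : ∀ q ∈ Metric.closedBall t (t / 2) ×ˢ (Set.univ : Set ℝ), 0 < q.1 := by
    rintro q ⟨hq, -⟩
    rw [Metric.mem_closedBall, Real.dist_eq, abs_le] at hq
    linarith
  have hGt : ContinuousOn (fun q : ℝ × ℝ => heatKernel D (x - q.2) q.1)
      (Metric.closedBall t (t / 2) ×ˢ Set.univ) :=
    (heatKernel_cont D hD).comp (f := fun q : ℝ × ℝ => (x - q.2, q.1))
      (by fun_prop) hball
  have hft : Continuous (fun q : ℝ × ℝ => f q.2 q.1) := hfc.comp continuous_swap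
  have hgt : Continuous (fun q : ℝ × ℝ => g q.2 q.1) := hgc.comp continuous_swap
  have hcoef : ContinuousOn (fun q : ℝ × ℝ => (x - q.2) ^ 2 / (4 * D * q.1 ^ 2) - 1 / (2 * q.1) - b)
      (Metric.closedBall t (t / 2) ×ˢ Set.univ) := by
    refine ((ContinuousOn.div (by fun_prop) (by fun_prop) ?_).sub
      (ContinuousOn.div (by fun_prop) (by fun_prop) ?_)).sub continuousOn_const
    · intro q hq; have := hball q hq; positivity
    · intro q hq; have := hball q hq; positivity
  have T := diff_param (fun s y => heatKernel D (x - y) s * Real.exp (-b * s) * f y s)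
    (fun s y => ((x - y) ^ 2 / (4 * D * s ^ 2) - 1 / (2 * s) - b) *
      (heatKernel D (x - y) s * Real.exp (-b * s) * f y s)
      + heatKernel D (x - y) s * Real.exp (-b * s) * g y s)
    K hK t (t / 2) (by positivity) (by fun_prop)
    (by
      refine (hcoef.mul ((hGt.mul ?_).mul hft.continuousOn)).add
        ((hGt.mul ?_).mul hgt.continuousOn) <;> fun_prop)
    (fun s y hy => by simp [hz y s hy]) (fun s y hy => by simp [hz y s hy, hgz y s hy])
    (fun s hs y => by
      have hs0 : 0 < s := hball (s, 0) ⟨hs, trivial⟩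
      have he : HasDerivAt (fun s : ℝ => Real.exp (-b * s)) (Real.exp (-b * s) * -b) s := by
        simpa using ((hasDerivAt_id s).const_mul (-b)).exp
      refine HasDerivAt.congr_deriv (((heatKernel_hasDerivAt_t D s (x - y) hD hs0).fun_mul he).fun_mul (hgd y s)) ?_
      ring)
  have hdd : deriv (fun ξ => ∫ y : ℝ, heatKernel D (ξ - y) t * Real.exp (-b * t) * f y t)
      = fun ξ => ∫ y : ℝ,
        -(ξ - y) / (2 * D * t) * heatKernel D (ξ - y) t * Real.exp (-b * t) * f y t :=
    funext fun ξ => (X1 ξ).2.2.deriv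
  rw [hdd, X2.2.2.deriv, T.2.2.deriv, ← integral_const_mul, ← integral_const_mul,
    ← integral_sub T.2.1 (X2.2.1.const_mul D)]
  refine (integral_add (T.2.1.sub (X2.2.1.const_mul D)) ((X1 x).1.const_mul b)).symm.trans ?_
  congr 1
  funext y
  change _ = heatKernel D (x - y) t * Real.exp (-b * t) * g y t
  simp only [Pi.sub_apply]
  field_simp
  ring
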